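/- Every invariant probability measure μ on 𝕊^L for the random dynamics (i.e. every μ with μ(A) = ∫_{𝕊^L} P(ℛ(1+λrU)·v ∈ A) dμ(v) for all Borel A ⊆ 𝕊^L) is absolutely continuous with respect to the normalized surface measure ν_L. -/

import Mathlib

open MeasureTheory ProbabilityTheory Matrix Real
open scoped ENNReal

noncomputable section

abbrev Sph (L : ℕ) := Metric.sphere (0 : EuclideanSpace ℝ (Fin (L+1))) 1

/-- The projective action `T · v = T v / ‖T v‖` on vectors. -/
noncomputable def act {n : ℕ} (T : Matrix (Fin n) (Fin n) ℝ)
    (v : EuclideanSpace ℝ (Fin n)) : EuclideanSpace ℝ (Fin n) :=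
  ‖Matrix.toEuclideanLin T v‖⁻¹ • Matrix.toEuclideanLin T v

/-- The projective action on the unit sphere (junk value `v` if `T v = 0`). -/
noncomputable def actS {L : ℕ} (T : Matrix (Fin (L+1)) (Fin (L+1)) ℝ) (v : Sph L) : Sph L :=
  if h : ‖Matrix.toEuclideanLin T (v : EuclideanSpace ℝ (Fin (L+1)))‖ = 0 then v
  else ⟨act T v, by
    rw [mem_sphere_zero_iff_norm, act, norm_smul, norm_inv, norm_norm, inv_mul_cancel₀ h]⟩

instance {m n α : Type*} [MeasurableSpace α] : MeasurableSpace (Matrix m n α) :=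
  inferInstanceAs (MeasurableSpace (m → n → α))

/-- `U` is Haar distributed on the orthogonal group `O(L+1)`: it takes values in the
orthogonal group and its law is invariant under left translation (which characterizes
the Haar probability measure on this compact group). -/
def IsHaarOrth {L : ℕ} {Ω : Type*} [MeasurableSpace Ω] (P : Measure Ω)
    (U : Ω → Matrix (Fin (L+1)) (Fin (L+1)) ℝ) : Prop :=
  Measurable U ∧ (∀ ω, U ω ∈ Matrix.orthogonalGroup (Fin (L+1)) ℝ) ∧
    ∀ O ∈ Matrix.orthogonalGroup (Fin (L+1)) ℝ,
      Measure.map (fun ω => O * U ω) P = Measure.map U P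

/-- `ν` is the normalized rotation-invariant surface measure on the sphere: it is the unique
rotation-invariant Borel probability measure. -/
def IsUniformSphere {L : ℕ} (ν : Measure (Sph L)) : Prop :=
  IsProbabilityMeasure ν ∧
    ∀ O ∈ Matrix.orthogonalGroup (Fin (L+1)) ℝ, Measure.map (actS O) ν = ν

/-- Topological support of a measure. -/
def msupport {X : Type*} [TopologicalSpace X] [MeasurableSpace X] (μ : Measure X) : Set X :=
  {x | ∀ s : Set X, IsOpen s → x ∈ s → 0 < μ s}

/-- `‖𝔞(v)‖²`, the squared norm of the first `La` components. -/
noncomputable def naSq {n : ℕ} (La : ℕ) (v : EuclideanSpace ℝ (Fin n)) : ℝ :=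
  ∑ k : Fin n, if (k : ℕ) < La then (v k)^2 else 0

/-- `‖𝔠(v)‖²`, the squared norm of the components with index `> La + Lb`. -/
noncomputable def ncSq {n : ℕ} (Lab : ℕ) (v : EuclideanSpace ℝ (Fin n)) : ℝ :=
  ∑ k : Fin n, if Lab ≤ (k : ℕ) then (v k)^2 else 0

/-- Ordered application of the (random) matrices `M 0, …, M (N-1)` to `v`. -/
noncomputable def chainW {L : ℕ} {Ω : Type*}
    (M : ℕ → Ω → Matrix (Fin (L+1)) (Fin (L+1)) ℝ) :
    ℕ → Ω → Sph L → Sph L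
  | 0, _, v => v
  | (n+1), ω, v => actS (M n ω) (chainW M n ω v)

/-- Ordered application of the matrices `M 0, …, M (N-1)` to `v` (deterministic). -/
noncomputable def chainD {L : ℕ} (M : ℕ → Matrix (Fin (L+1)) (Fin (L+1)) ℝ) :
    ℕ → Sph L → Sph L
  | 0, v => v
  | (n+1), v => actS (M n) (chainD M n v)
theorem measure_norm_smul_add_smul_mem_eq_zero {E : Type*} [NormedAddCommGroup E]
    [InnerProductSpace ℝ E] [FiniteDimensional ℝ E] [MeasurableSpace E] [BorelSpace E]
    (μ : Measure E) [μ.IsAddHaarMeasure] {v : E} (hv : ‖v‖ = 1) {s : ℝ} (hs0 : 0 < s)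
    (hs1 : s < 1) {B : Set E} (hB : μ B = 0) :
    μ {x | ‖x‖ • v + s • x ∈ B} = 0 := by
  set D : E → ℝ := fun y => (inner ℝ y v) ^ 2 - (1 - s ^ 2) * ‖y‖ ^ 2 with hD
  set ρ : ℝ → E → ℝ := fun ε y => (inner ℝ y v + ε * √(D y)) / (1 - s ^ 2) with hρ
  set G : ℝ → E → E := fun ε y => s⁻¹ • (y - ρ ε y • v) with hG
  set Z : Set E := {x | inner ℝ x v + s * ‖x‖ = 0} with hZ
  have hs2 : (1 - s ^ 2) ≠ 0 := by nlinarith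
  have hvv : inner ℝ v v = (1 : ℝ) := by rw [real_inner_self_eq_norm_sq, hv]; norm_num
  have hZ0 : μ Z = 0 := by
    refine Measure.addHaar_eq_zero_of_disjoint_translates μ
      (fun n : ℕ => ((n : ℝ) + 1)⁻¹ • v) ?_ ?_ ?_
    · refine (Metric.isBounded_closedBall (x := (0 : E)) (r := 1)).subset ?_
      rintro _ ⟨n, rfl⟩
      rw [mem_closedBall_zero_iff, norm_smul, hv, mul_one, Real.norm_of_nonneg (by positivity)]
      exact inv_le_one_of_one_le₀ (by linarith [(Nat.cast_nonneg n : (0 : ℝ) ≤ n)])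
    · intro m n hmn
      refine Set.disjoint_left.2 ?_
      simp only [Set.singleton_add, Set.mem_image]
      rintro _ ⟨x, hx, rfl⟩ ⟨y, hy, hxy⟩
      set a : ℝ := ((m : ℝ) + 1)⁻¹ with ha
      set b : ℝ := ((n : ℝ) + 1)⁻¹ with hb
      have hy' : y = x + (a - b) • v := by
        rw [sub_smul, ← sub_eq_zero]
        have := sub_eq_zero.2 hxy
        rw [← this]; abel
      have h1 : inner ℝ y v = inner ℝ x v + (a - b) := by
        rw [hy', inner_add_left, inner_smul_left, hvv]; simp
      have h2 : |‖y‖ - ‖x‖| ≤ |a - b| := by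
        refine (abs_norm_sub_norm_le y x).trans ?_
        rw [hy', add_sub_cancel_left, norm_smul, hv, mul_one, Real.norm_eq_abs]
      have hx0 : inner ℝ x v + s * ‖x‖ = 0 := hx
      have hy0 : inner ℝ y v + s * ‖y‖ = 0 := hy
      have h3 : a - b = - s * (‖y‖ - ‖x‖) := by linarith
      have h4 : |a - b| ≤ s * |a - b| := by
        conv_lhs => rw [h3, abs_mul, abs_neg, abs_of_pos hs0]
        gcongr
      have h5 : a - b = 0 := by
        rw [← abs_eq_zero]
        nlinarith [abs_nonneg (a - b)]
      have h6 : (m : ℝ) + 1 = n + 1 := inv_injective (sub_eq_zero.1 h5)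
      exact hmn (by exact_mod_cast add_right_cancel h6)
    · exact (isClosed_singleton.preimage
        (f := fun x : E => inner ℝ x v + s * ‖x‖) (t := {(0 : ℝ)}) (by fun_prop)).measurableSet
  have hG0 : ∀ ε, μ (G ε '' (B ∩ {y | D y ≠ 0})) = 0 := by
    intro ε
    refine addHaar_image_eq_zero_of_differentiableOn_of_addHaar_eq_zero μ ?_
      (measure_mono_null Set.inter_subset_left hB)
    rintro y ⟨-, hy⟩
    have hDd : DifferentiableAt ℝ D y :=
      ((differentiableAt_id.inner ℝ (differentiableAt_const v)).pow 2).sub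
        ((differentiableAt_id.norm_sq ℝ).const_mul _)
    have hρd : DifferentiableAt ℝ (ρ ε) y := by
      simp only [hρ, div_eq_mul_inv]
      exact ((differentiableAt_id.inner ℝ (differentiableAt_const v)).add
        ((hDd.sqrt hy).const_mul ε)).mul_const _
    exact ((differentiableAt_id.sub (hρd.smul_const v)).const_smul s⁻¹).differentiableWithinAt
  refine measure_mono_null (t := Z ∪ (G 1 '' (B ∩ {y | D y ≠ 0}) ∪ G (-1) '' (B ∩ {y | D y ≠ 0})))
    ?_ (measure_union_null hZ0 (measure_union_null (hG0 1) (hG0 (-1))))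
  intro x hx
  set y : E := ‖x‖ • v + s • x with hy
  by_cases hxZ : x ∈ Z
  · exact Or.inl hxZ
  right
  have hxZ' : inner ℝ x v + s * ‖x‖ ≠ 0 := hxZ
  have hyv : inner ℝ y v = ‖x‖ + s * inner ℝ x v := by
    rw [hy, inner_add_left, inner_smul_left, inner_smul_left, hvv]; simp
  have hyy : ‖y‖ ^ 2 = ‖x‖ ^ 2 + 2 * s * ‖x‖ * inner ℝ x v + s ^ 2 * ‖x‖ ^ 2 := by
    rw [hy, norm_add_sq_real, norm_smul, norm_smul, hv, inner_smul_left, inner_smul_right,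
      real_inner_comm]
    simp only [Real.norm_eq_abs, mul_pow, sq_abs, conj_trivial]
    ring
  have hDy : D y = (s * (inner ℝ x v + s * ‖x‖)) ^ 2 := by
    simp only [hD, hyv, hyy]; ring
  have hDne : D y ≠ 0 := by rw [hDy]; exact pow_ne_zero 2 (mul_ne_zero hs0.ne' hxZ')
  have key : ∀ ε, ε * √(D y) = -(s * (inner ℝ x v + s * ‖x‖)) → G ε y = x := by
    intro ε hε
    have : ρ ε y = ‖x‖ := by
      simp only [hρ, hε, hyv]
      rw [div_eq_iff hs2]; ring
    simp only [hG, this]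
    rw [hy, add_sub_cancel_left, smul_smul, inv_mul_cancel₀ hs0.ne', one_smul]
  rcases le_total 0 (s * (inner ℝ x v + s * ‖x‖)) with h | h
  · exact Or.inr ⟨y, ⟨hx, hDne⟩, key _ (by rw [hDy, Real.sqrt_sq h]; ring)⟩
  · exact Or.inl ⟨y, ⟨hx, hDne⟩, key _ (by rw [hDy, Real.sqrt_sq_eq_abs, abs_of_nonpos h]; ring)⟩

/-- Radial projection `x ↦ x / ‖x‖` onto the sphere, with an arbitrary value at `0`. -/
def sphNormalize {L : ℕ} (x : EuclideanSpace ℝ (Fin (L+1))) : Sph L :=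
  if h : x = 0 then ⟨EuclideanSpace.single 0 1, by simp⟩
  else ⟨‖x‖⁻¹ • x, by
    rw [mem_sphere_zero_iff_norm, norm_smul, norm_inv, norm_norm,
      inv_mul_cancel₀ (norm_ne_zero_iff.2 h)]⟩

theorem coe_sphNormalize {L : ℕ} {x : EuclideanSpace ℝ (Fin (L+1))} (hx : x ≠ 0) :
    (sphNormalize x : EuclideanSpace ℝ (Fin (L+1))) = ‖x‖⁻¹ • x := by
  rw [sphNormalize, dif_neg hx]

theorem sphNormalize_smul {L : ℕ} {c : ℝ} (hc : 0 < c) (x : EuclideanSpace ℝ (Fin (L+1))) :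
    sphNormalize (c • x) = sphNormalize x := by
  by_cases hx : x = 0
  · rw [hx, smul_zero]
  · refine Subtype.ext ?_
    rw [coe_sphNormalize hx, coe_sphNormalize (smul_ne_zero hc.ne' hx), norm_smul, smul_smul,
      Real.norm_of_nonneg hc.le, mul_inv, mul_right_comm, inv_mul_cancel₀ hc.ne', one_mul]

theorem actS_eq_sphNormalize {L : ℕ} {T : Matrix (Fin (L+1)) (Fin (L+1)) ℝ} {v : Sph L}
    (h : Matrix.toEuclideanLin T (v : EuclideanSpace ℝ (Fin (L+1))) ≠ 0) :
    actS T v = sphNormalize (Matrix.toEuclideanLin T (v : EuclideanSpace ℝ (Fin (L+1)))) := by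
  refine Subtype.ext ?_
  rw [coe_sphNormalize h, actS, dif_neg (norm_ne_zero_iff.2 h)]
  rfl

theorem measurable_sphNormalize {L : ℕ} : Measurable (sphNormalize (L := L)) := by
  rw [← (MeasurableEmbedding.subtype_coe
    (Metric.isClosed_sphere.measurableSet)).measurable_comp_iff]
  have : ((↑) : Sph L → EuclideanSpace ℝ (Fin (L+1))) ∘ sphNormalize =
      fun x => if x = 0 then EuclideanSpace.single 0 1 else ‖x‖⁻¹ • x := by
    funext x
    simp only [Function.comp, sphNormalize]
    split_ifs <;> rfl
  rw [this]
  exact Measurable.ite (measurableSet_singleton 0) measurable_const (by fun_prop)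

theorem toEuclideanLin_mul_apply {L : ℕ} (S T : Matrix (Fin (L+1)) (Fin (L+1)) ℝ)
    (x : EuclideanSpace ℝ (Fin (L+1))) :
    Matrix.toEuclideanLin (S * T) x = Matrix.toEuclideanLin S (Matrix.toEuclideanLin T x) := by
  simp [Matrix.toLpLin_apply, Matrix.mulVec_mulVec]

theorem toEuclideanLin_one_apply {L : ℕ} (x : EuclideanSpace ℝ (Fin (L+1))) :
    Matrix.toEuclideanLin (1 : Matrix (Fin (L+1)) (Fin (L+1)) ℝ) x = x := by
  simp

theorem measurable_matrix_entry {m n : Type*} (i : m) (j : n) :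
    Measurable fun M : Matrix m n ℝ => M i j :=
  (measurable_pi_apply j).comp (measurable_pi_apply (X := fun _ : m => n → ℝ) i)

theorem measurable_matrix_of_entry {α m n : Type*} [MeasurableSpace α] {f : α → Matrix m n ℝ}
    (h : ∀ i j, Measurable fun a => f a i j) : Measurable f :=
  measurable_pi_iff.2 fun i => measurable_pi_iff.2 (h i)

theorem Measurable.toEuclideanLin_apply {L : ℕ} {α : Type*} [MeasurableSpace α]
    {f : α → Matrix (Fin (L+1)) (Fin (L+1)) ℝ} {g : α → EuclideanSpace ℝ (Fin (L+1))}
    (hf : Measurable f) (hg : Measurable g) :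
    Measurable fun a => Matrix.toEuclideanLin (f a) (g a) := by
  have h : Measurable fun a => f a *ᵥ (g a).ofLp := by
    refine measurable_pi_iff.2 fun i => ?_
    simp only [Matrix.mulVec, dotProduct]
    refine Finset.measurable_sum _ fun j _ => ?_
    have h1 : Measurable fun a => f a i j := (measurable_matrix_entry i j).comp hf
    have h2 : Measurable fun a => (g a).ofLp j :=
      (measurable_pi_apply j).comp ((WithLp.measurable_ofLp 2 _).comp hg)
    exact h1.mul h2
  exact (WithLp.measurable_toLp 2 _).comp h

theorem Measurable.actS {L : ℕ} {α : Type*} [MeasurableSpace α]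
    {f : α → Matrix (Fin (L+1)) (Fin (L+1)) ℝ} {g : α → Sph L}
    (hf : Measurable f) (hg : Measurable g) : Measurable fun a => actS (f a) (g a) := by
  have hm : Measurable fun a =>
      Matrix.toEuclideanLin (f a) (g a : EuclideanSpace ℝ (Fin (L+1))) :=
    hf.toEuclideanLin_apply (measurable_subtype_coe.comp hg)
  have : (fun a => _root_.actS (f a) (g a)) = fun a =>
      if Matrix.toEuclideanLin (f a) (g a : EuclideanSpace ℝ (Fin (L+1))) = 0 then g a
      else sphNormalize (Matrix.toEuclideanLin (f a) (g a : EuclideanSpace ℝ (Fin (L+1)))) := by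
    funext a
    split_ifs with h
    · rw [_root_.actS, dif_pos (norm_eq_zero.2 h)]
    · exact actS_eq_sphNormalize h
  rw [this]
  exact Measurable.ite (hm (measurableSet_singleton 0)) hg (measurable_sphNormalize.comp hm)

theorem measurable_actS {L : ℕ} (T : Matrix (Fin (L+1)) (Fin (L+1)) ℝ) : Measurable (actS T) :=
  Measurable.actS measurable_const measurable_id

theorem Measurable.matrix_const_mul {n α : Type*} [Fintype n] [MeasurableSpace α]
    {f : α → Matrix n n ℝ} (hf : Measurable f) (O : Matrix n n ℝ) :
    Measurable fun a => O * f a := by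
  refine measurable_matrix_of_entry fun i j => ?_
  simp only [Matrix.mul_apply]
  exact Finset.measurable_sum _ fun k _ => ((measurable_matrix_entry k j).comp hf).const_mul _

theorem transpose_mul_self_of_mem_orthogonalGroup {n : Type*} [Fintype n] [DecidableEq n]
    {O : Matrix n n ℝ} (hO : O ∈ Matrix.orthogonalGroup n ℝ) : Oᵀ * O = 1 := by
  have := (Matrix.mem_orthogonalGroup_iff' n ℝ).1 hO
  exact this

theorem transpose_mem_orthogonalGroup {n : Type*} [Fintype n] [DecidableEq n]
    {O : Matrix n n ℝ} (hO : O ∈ Matrix.orthogonalGroup n ℝ) :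
    Oᵀ ∈ Matrix.orthogonalGroup n ℝ := by
  rw [Matrix.mem_orthogonalGroup_iff']
  have := (Matrix.mem_orthogonalGroup_iff n ℝ).1 hO
  simpa using this

theorem norm_toEuclideanLin_of_mem_orthogonalGroup {L : ℕ}
    {O : Matrix (Fin (L+1)) (Fin (L+1)) ℝ} (hO : O ∈ Matrix.orthogonalGroup (Fin (L+1)) ℝ)
    (x : EuclideanSpace ℝ (Fin (L+1))) : ‖Matrix.toEuclideanLin O x‖ = ‖x‖ := by
  have h : ‖Matrix.toEuclideanLin O x‖ ^ 2 = ‖x‖ ^ 2 := by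
    rw [← real_inner_self_eq_norm_sq, ← real_inner_self_eq_norm_sq,
      ← LinearMap.adjoint_inner_left, ← Matrix.toEuclideanLin_conjTranspose_eq_adjoint,
      ← toEuclideanLin_mul_apply, Matrix.conjTranspose_eq_transpose_of_trivial,
      transpose_mul_self_of_mem_orthogonalGroup hO, toEuclideanLin_one_apply]
  exact (sq_eq_sq₀ (norm_nonneg _) (norm_nonneg _)).1 h

theorem toEuclideanLin_coe_ne_zero_of_mem_orthogonalGroup {L : ℕ}
    {O : Matrix (Fin (L+1)) (Fin (L+1)) ℝ} (hO : O ∈ Matrix.orthogonalGroup (Fin (L+1)) ℝ)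
    (v : Sph L) : Matrix.toEuclideanLin O (v : EuclideanSpace ℝ (Fin (L+1))) ≠ 0 := by
  rw [← norm_ne_zero_iff, norm_toEuclideanLin_of_mem_orthogonalGroup hO,
    mem_sphere_zero_iff_norm.1 v.2]
  exact one_ne_zero

theorem exists_orthogonal_toEuclideanLin_eq {L : ℕ} {x y : EuclideanSpace ℝ (Fin (L+1))}
    (h : ‖x‖ = ‖y‖) :
    ∃ O ∈ Matrix.orthogonalGroup (Fin (L+1)) ℝ, Matrix.toEuclideanLin O x = y := by
  set f := (ℝ ∙ (x - y))ᗮ.reflection with hf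
  set b := EuclideanSpace.basisFun (Fin (L+1)) ℝ with hb
  refine ⟨_, LinearIsometryEquiv.toMatrix_mem_unitaryGroup f b b, ?_⟩
  rw [Matrix.toEuclideanLin_eq_toLin_orthonormal, Matrix.toLin_toMatrix]
  exact Submodule.reflection_sub h

theorem actS_actS_of_mem_orthogonalGroup {L : ℕ} {S T : Matrix (Fin (L+1)) (Fin (L+1)) ℝ}
    (hS : S ∈ Matrix.orthogonalGroup (Fin (L+1)) ℝ)
    (hT : T ∈ Matrix.orthogonalGroup (Fin (L+1)) ℝ) (v : Sph L) :
    actS S (actS T v) = actS (S * T) v := by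
  rw [actS_eq_sphNormalize (toEuclideanLin_coe_ne_zero_of_mem_orthogonalGroup (mul_mem hS hT) v),
    actS_eq_sphNormalize (toEuclideanLin_coe_ne_zero_of_mem_orthogonalGroup hS _),
    actS_eq_sphNormalize (toEuclideanLin_coe_ne_zero_of_mem_orthogonalGroup hT _),
    coe_sphNormalize (toEuclideanLin_coe_ne_zero_of_mem_orthogonalGroup hT _), map_smul,
    sphNormalize_smul (inv_pos.2 (norm_pos_iff.2
      (toEuclideanLin_coe_ne_zero_of_mem_orthogonalGroup hT _))), toEuclideanLin_mul_apply]

theorem IsHaarOrth.measure_actS_transpose_mem_eq {L : ℕ} {Ω : Type*} [MeasurableSpace Ω]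
    {P : Measure Ω} {U : Ω → Matrix (Fin (L+1)) (Fin (L+1)) ℝ} (hU : IsHaarOrth P U)
    {A : Set (Sph L)} (hA : MeasurableSet A) (v w : Sph L) :
    P {ω | actS (U ω)ᵀ v ∈ A} = P {ω | actS (U ω)ᵀ w ∈ A} := by
  obtain ⟨O, hO, hOv⟩ := exists_orthogonal_toEuclideanLin_eq
    (x := (w : EuclideanSpace ℝ (Fin (L+1)))) (y := v)
    (by rw [mem_sphere_zero_iff_norm.1 v.2, mem_sphere_zero_iff_norm.1 w.2])
  have htr : Measurable fun M : Matrix (Fin (L+1)) (Fin (L+1)) ℝ => Mᵀ :=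
    measurable_matrix_of_entry fun i j => measurable_matrix_entry j i
  have hset : MeasurableSet {M : Matrix (Fin (L+1)) (Fin (L+1)) ℝ | actS Mᵀ v ∈ A} :=
    (htr.actS measurable_const) hA
  have h := congrArg (fun m => m {M | actS Mᵀ v ∈ A}) (hU.2.2 O hO)
  beta_reduce at h
  rw [Measure.map_apply (hU.1.matrix_const_mul O) hset, Measure.map_apply hU.1 hset] at h
  refine h.symm.trans (congrArg P ?_)
  ext ω
  have hUt := transpose_mem_orthogonalGroup (hU.2.1 ω)
  have hOU := transpose_mem_orthogonalGroup (mul_mem hO (hU.2.1 ω))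
  simp only [Set.mem_preimage, Set.mem_ofPred_eq]
  rw [actS_eq_sphNormalize (toEuclideanLin_coe_ne_zero_of_mem_orthogonalGroup hOU v),
    actS_eq_sphNormalize (toEuclideanLin_coe_ne_zero_of_mem_orthogonalGroup hUt w),
    ← hOv, ← toEuclideanLin_mul_apply, Matrix.transpose_mul, Matrix.mul_assoc,
    transpose_mul_self_of_mem_orthogonalGroup hO, Matrix.mul_one]

theorem IsHaarOrth.measure_eq_of_map_actS_eq {L : ℕ} {Ω : Type*} [MeasurableSpace Ω]
    {P : Measure Ω} [IsProbabilityMeasure P] {U : Ω → Matrix (Fin (L+1)) (Fin (L+1)) ℝ}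
    (hU : IsHaarOrth P U) {σ : Measure (Sph L)} [SFinite σ]
    (hσ : ∀ O ∈ Matrix.orthogonalGroup (Fin (L+1)) ℝ, Measure.map (actS O) σ = σ)
    {A : Set (Sph L)} (hA : MeasurableSet A) (e : Sph L) :
    σ A = P {ω | actS (U ω)ᵀ e ∈ A} * σ Set.univ := by
  have htr : Measurable fun ω => (U ω)ᵀ :=
    measurable_matrix_of_entry fun i j => (measurable_matrix_entry j i).comp hU.1
  have hm : Measurable fun p : Ω × Sph L => actS (U p.1)ᵀ p.2 :=
    (htr.comp measurable_fst).actS measurable_snd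
  calc σ A = ∫⁻ _, σ A ∂P := by simp
    _ = ∫⁻ ω, σ (actS (U ω)ᵀ ⁻¹' A) ∂P := by
        refine lintegral_congr fun ω => ?_
        rw [← Measure.map_apply (measurable_actS _) hA,
          hσ _ (transpose_mem_orthogonalGroup (hU.2.1 ω))]
    _ = (P.prod σ) ((fun p : Ω × Sph L => actS (U p.1)ᵀ p.2) ⁻¹' A) :=
        (Measure.prod_apply (hm hA)).symm
    _ = ∫⁻ w, P {ω | actS (U ω)ᵀ w ∈ A} ∂σ := Measure.prod_apply_symm (hm hA)
    _ = ∫⁻ _, P {ω | actS (U ω)ᵀ e ∈ A} ∂σ :=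
        lintegral_congr fun w => hU.measure_actS_transpose_mem_eq hA w e
    _ = _ := lintegral_const _

theorem map_actS_map_sphNormalize_volume {L : ℕ} {O : Matrix (Fin (L+1)) (Fin (L+1)) ℝ}
    (hO : O ∈ Matrix.orthogonalGroup (Fin (L+1)) ℝ) :
    Measure.map (actS O) (Measure.map sphNormalize volume) =
      Measure.map sphNormalize (volume : Measure (EuclideanSpace ℝ (Fin (L+1)))) := by
  let f : EuclideanSpace ℝ (Fin (L+1)) →ₗᵢ[ℝ] EuclideanSpace ℝ (Fin (L+1)) :=
    ⟨Matrix.toEuclideanLin O, norm_toEuclideanLin_of_mem_orthogonalGroup hO⟩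
  have hf := (f.toLinearIsometryEquiv rfl).measurePreserving
  rw [Measure.map_map (measurable_actS O) measurable_sphNormalize]
  conv_rhs => rw [← hf.map_eq, Measure.map_map measurable_sphNormalize hf.measurable]
  refine Measure.map_congr ?_
  filter_upwards [compl_mem_ae_iff.2 (measure_singleton (0 : EuclideanSpace ℝ (Fin (L+1))))]
    with x hx
  have hx : x ≠ 0 := hx
  simp only [Function.comp]
  rw [actS_eq_sphNormalize (toEuclideanLin_coe_ne_zero_of_mem_orthogonalGroup hO _),
    coe_sphNormalize hx, map_smul, sphNormalize_smul (inv_pos.2 (norm_pos_iff.2 hx))]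
  rfl

theorem volume_preimage_sphNormalize_eq_zero_iff {L : ℕ} {Ω : Type*} [MeasurableSpace Ω]
    {P : Measure Ω} [IsProbabilityMeasure P] {U : Ω → Matrix (Fin (L+1)) (Fin (L+1)) ℝ}
    (hU : IsHaarOrth P U) {ν : Measure (Sph L)} (hν : IsUniformSphere ν)
    {A : Set (Sph L)} (hA : MeasurableSet A) :
    volume (sphNormalize ⁻¹' A) = 0 ↔ ν A = 0 := by
  have := hν.1
  let e : Sph L := sphNormalize 0
  rw [← Measure.map_apply measurable_sphNormalize hA,
    hU.measure_eq_of_map_actS_eq (fun O hO => map_actS_map_sphNormalize_volume hO) hA e,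
    hU.measure_eq_of_map_actS_eq hν.2 hA e, measure_univ (μ := ν), mul_one,
    Measure.map_apply measurable_sphNormalize MeasurableSet.univ, Set.preimage_univ, mul_eq_zero]
  simp

theorem IsHaarOrth.measure_actS_mem_eq {L : ℕ} {Ω : Type*} [MeasurableSpace Ω]
    {P : Measure Ω} [IsProbabilityMeasure P] {U : Ω → Matrix (Fin (L+1)) (Fin (L+1)) ℝ}
    (hU : IsHaarOrth P U) {ν : Measure (Sph L)} (hν : IsUniformSphere ν)
    {A : Set (Sph L)} (hA : MeasurableSet A) (v : Sph L) :
    P {ω | actS (U ω) v ∈ A} = ν A := by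
  have := hν.1
  have hm : Measurable fun M : Matrix (Fin (L+1)) (Fin (L+1)) ℝ => actS M v :=
    measurable_id.actS measurable_const
  have hmU : Measurable fun ω => actS (U ω) v := hm.comp hU.1
  have hprob : IsProbabilityMeasure (P.map fun ω => actS (U ω) v) :=
    Measure.isProbabilityMeasure_map hmU.aemeasurable
  have hinv : ∀ O ∈ Matrix.orthogonalGroup (Fin (L+1)) ℝ,
      Measure.map (actS O) (P.map fun ω => actS (U ω) v) = P.map fun ω => actS (U ω) v := by
    intro O hO
    rw [Measure.map_map (measurable_actS O) hmU]
    have h1 : (actS O ∘ fun ω => actS (U ω) v) =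
        (fun M => actS M v) ∘ fun ω => O * U ω :=
      funext fun ω => actS_actS_of_mem_orthogonalGroup hO (hU.2.1 ω) v
    rw [h1, ← Measure.map_map hm (hU.1.matrix_const_mul O), hU.2.2 O hO, Measure.map_map hm hU.1]
    rfl
  have h := hU.measure_eq_of_map_actS_eq hinv hA v
  rw [Measure.map_apply hmU hA, measure_univ] at h
  rw [hU.measure_eq_of_map_actS_eq hν.2 hA v, measure_univ (μ := ν)]
  exact h

theorem actS_sphNormalize {L : ℕ} {R : Matrix (Fin (L+1)) (Fin (L+1)) ℝ}
    {x : EuclideanSpace ℝ (Fin (L+1))} (hx : x ≠ 0) (hRx : Matrix.toEuclideanLin R x ≠ 0) :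
    actS R (sphNormalize x) = sphNormalize (Matrix.toEuclideanLin R x) := by
  have h : Matrix.toEuclideanLin R (sphNormalize x : EuclideanSpace ℝ (Fin (L+1))) =
      ‖x‖⁻¹ • Matrix.toEuclideanLin R x := by rw [coe_sphNormalize hx, map_smul]
  have hpos : 0 < ‖x‖⁻¹ := inv_pos.2 (norm_pos_iff.2 hx)
  rw [actS_eq_sphNormalize (h ▸ smul_ne_zero hpos.ne' hRx), h, sphNormalize_smul hpos]

theorem det_toEuclideanLin {L : ℕ} (R : Matrix (Fin (L+1)) (Fin (L+1)) ℝ) :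
    LinearMap.det (Matrix.toEuclideanLin R) = R.det := by
  rw [Matrix.toEuclideanLin_eq_toLin_orthonormal, LinearMap.det_toLin]

theorem toEuclideanLin_apply_ne_zero {L : ℕ} {R : Matrix (Fin (L+1)) (Fin (L+1)) ℝ}
    (hR : R.det ≠ 0) {x : EuclideanSpace ℝ (Fin (L+1))} (hx : x ≠ 0) :
    Matrix.toEuclideanLin R x ≠ 0 := by
  intro h
  apply hx
  rw [← toEuclideanLin_one_apply x, ← Matrix.nonsing_inv_mul R (isUnit_iff_ne_zero.2 hR),
    toEuclideanLin_mul_apply, h, map_zero]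

section

variable {L : ℕ} {Ω : Type*} [MeasurableSpace Ω] {P : Measure Ω} [IsProbabilityMeasure P]
  {U : Ω → Matrix (Fin (L+1)) (Fin (L+1)) ℝ} {ν : Measure (Sph L)} {A : Set (Sph L)}
  {R : Matrix (Fin (L+1)) (Fin (L+1)) ℝ}

theorem measure_preimage_actS_eq_zero (hU : IsHaarOrth P U) (hν : IsUniformSphere ν)
    (hA : MeasurableSet A) (hνA : ν A = 0) (hR : R.det ≠ 0) : ν (actS R ⁻¹' A) = 0 := by
  rw [← volume_preimage_sphNormalize_eq_zero_iff hU hν hA] at hνA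
  rw [← volume_preimage_sphNormalize_eq_zero_iff hU hν (measurable_actS R hA)]
  have h : volume (Matrix.toEuclideanLin R ⁻¹' (sphNormalize ⁻¹' A)) = 0 := by
    rw [Measure.addHaar_preimage_linearMap _ (by rwa [det_toEuclideanLin]), hνA, mul_zero]
  refine measure_mono_null (fun x hx => ?_) (measure_union_null (measure_singleton 0) h)
  by_cases hx0 : x = 0
  · exact Or.inl hx0
  · right
    have hx : actS R (sphNormalize x) ∈ A := hx
    rwa [actS_sphNormalize hx0 (toEuclideanLin_apply_ne_zero hR hx0)] at hx

theorem measure_sphNormalize_add_smul_mem_eq_zero (hU : IsHaarOrth P U)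
    (hν : IsUniformSphere ν) (hA : MeasurableSet A) (hνA : ν A = 0) {s : ℝ} (hs0 : 0 < s)
    (hs1 : s < 1) (v : Sph L) :
    ν {w : Sph L | sphNormalize
      ((v : EuclideanSpace ℝ (Fin (L+1))) + s • (w : EuclideanSpace ℝ (Fin (L+1)))) ∈ A} = 0 := by
  have hW : MeasurableSet {w : Sph L | sphNormalize
      ((v : EuclideanSpace ℝ (Fin (L+1))) + s • (w : EuclideanSpace ℝ (Fin (L+1)))) ∈ A} :=
    (measurable_sphNormalize.comp ((measurable_subtype_coe.const_smul s).const_add _)) hA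
  rw [← volume_preimage_sphNormalize_eq_zero_iff hU hν hA] at hνA
  rw [← volume_preimage_sphNormalize_eq_zero_iff hU hν hW]
  refine measure_mono_null (fun x hx => ?_) (measure_union_null (measure_singleton 0)
    (measure_norm_smul_add_smul_mem_eq_zero volume (mem_sphere_zero_iff_norm.1 v.2) hs0 hs1 hνA))
  by_cases hx0 : x = 0
  · exact Or.inl hx0
  · right
    have hx : sphNormalize ((v : EuclideanSpace ℝ (Fin (L+1))) +
      s • (sphNormalize x : EuclideanSpace ℝ (Fin (L+1)))) ∈ A := hx
    rw [← sphNormalize_smul (norm_pos_iff.2 hx0), coe_sphNormalize hx0, smul_add,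
      smul_comm s, smul_smul, mul_inv_cancel₀ (norm_ne_zero_iff.2 hx0), one_smul] at hx
    exact hx

theorem IsHaarOrth.measure_actS_mul_one_add_smul_mem_eq_zero (hU : IsHaarOrth P U)
    (hν : IsUniformSphere ν) (hA : MeasurableSet A) (hνA : ν A = 0) (hR : R.det ≠ 0) {s : ℝ}
    (hs0 : 0 < s) (hs1 : s < 1) (v : Sph L) :
    P {ω | actS (R * (1 + s • U ω)) v ∈ A} = 0 := by
  have hB := measurable_actS R hA
  have hW : MeasurableSet {w : Sph L | sphNormalize
      ((v : EuclideanSpace ℝ (Fin (L+1))) + s • (w : EuclideanSpace ℝ (Fin (L+1)))) ∈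
        actS R ⁻¹' A} :=
    (measurable_sphNormalize.comp ((measurable_subtype_coe.const_smul s).const_add _)) hB
  have h := hU.measure_actS_mem_eq hν hW v
  rw [measure_sphNormalize_add_smul_mem_eq_zero hU hν hB
    (measure_preimage_actS_eq_zero hU hν hA hνA hR) hs0 hs1 v] at h
  rw [← h]
  refine congrArg P (Set.ext fun ω => ?_)
  have hv := mem_sphere_zero_iff_norm.1 v.2
  have hUv : (actS (U ω) v : EuclideanSpace ℝ (Fin (L+1))) = Matrix.toEuclideanLin (U ω) v := by
    have h0 := toEuclideanLin_coe_ne_zero_of_mem_orthogonalGroup (hU.2.1 ω) v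
    rw [actS_eq_sphNormalize h0, coe_sphNormalize h0,
      norm_toEuclideanLin_of_mem_orthogonalGroup (hU.2.1 ω), hv, inv_one, one_smul]
  have hne : (v : EuclideanSpace ℝ (Fin (L+1))) + s • Matrix.toEuclideanLin (U ω) v ≠ 0 := by
    intro h0
    have h1 := congrArg norm (eq_neg_of_add_eq_zero_left h0)
    rw [norm_neg, norm_smul, norm_toEuclideanLin_of_mem_orthogonalGroup (hU.2.1 ω), hv,
      Real.norm_of_nonneg hs0.le] at h1
    linarith
  have hlin : Matrix.toEuclideanLin (R * (1 + s • U ω)) (v : EuclideanSpace ℝ (Fin (L+1))) =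
      Matrix.toEuclideanLin R
        ((v : EuclideanSpace ℝ (Fin (L+1))) + s • Matrix.toEuclideanLin (U ω) v) := by
    rw [toEuclideanLin_mul_apply, map_add, map_smul, LinearMap.add_apply, LinearMap.smul_apply,
      toEuclideanLin_one_apply]
  have hRne := toEuclideanLin_apply_ne_zero hR hne
  simp only [Set.mem_ofPred_eq, Set.mem_preimage]
  rw [hUv, actS_sphNormalize hne hRne, actS_eq_sphNormalize (hlin ▸ hRne), hlin]

theorem IsHaarOrth.measure_pos_and_actS_mem_eq_zero (hU : IsHaarOrth P U)
    (hν : IsUniformSphere ν) (hA : MeasurableSet A) (hνA : ν A = 0) (hR : R.det ≠ 0)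
    {lam : ℝ} (hlam : lam ∈ Set.Ioo (0 : ℝ) 1) {r : Ω → ℝ} (hr : Measurable r)
    (hr01 : ∀ ω, r ω ∈ Set.Icc (0 : ℝ) 1) (hrU : IndepFun r U P) (v : Sph L) :
    P {ω | r ω ≠ 0 ∧ actS (R * (1 + (lam * r ω) • U ω)) v ∈ A} = 0 := by
  set S : Set (ℝ × Matrix (Fin (L+1)) (Fin (L+1)) ℝ) :=
    {p | p.1 ∈ Set.Ioc 0 1 ∧ actS (R * (1 + (lam * p.1) • p.2)) v ∈ A} with hS
  have hf : Measurable fun p : ℝ × Matrix (Fin (L+1)) (Fin (L+1)) ℝ =>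
      (1 + (lam * p.1) • p.2 : Matrix (Fin (L+1)) (Fin (L+1)) ℝ) := by
    refine measurable_matrix_of_entry fun i j => ?_
    simp only [Matrix.add_apply, Matrix.smul_apply, smul_eq_mul]
    exact ((measurable_fst.const_mul lam).mul
      ((measurable_matrix_entry i j).comp measurable_snd)).const_add _
  have hSm : MeasurableSet S :=
    (measurable_fst measurableSet_Ioc).inter
      (((hf.matrix_const_mul R).actS measurable_const) hA)
  have hS0 : (P.map fun ω => (r ω, U ω)) S = 0 := by
    rw [(indepFun_iff_map_prod_eq_prod_map_map hr.aemeasurable hU.1.aemeasurable).1 hrU,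
      Measure.measure_prod_null hSm]
    refine Filter.Eventually.of_forall fun t => ?_
    beta_reduce
    rw [Measure.map_apply hU.1 (measurable_prodMk_left hSm), Pi.zero_apply]
    by_cases ht : t ∈ Set.Ioc (0 : ℝ) 1
    · refine measure_mono_null (fun ω hω => hω.2)
        (hU.measure_actS_mul_one_add_smul_mem_eq_zero hν hA hνA hR (s := lam * t)
          (mul_pos hlam.1 ht.1) ?_ v)
      nlinarith [hlam.1, hlam.2, ht.1, ht.2]
    · exact measure_mono_null (fun ω hω => ht hω.1) measure_empty
  rw [Measure.map_apply (hr.prodMk hU.1) hSm] at hS0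
  refine measure_mono_null (fun ω hω => ?_) hS0
  exact ⟨⟨lt_of_le_of_ne (hr01 ω).1 (Ne.symm hω.1), (hr01 ω).2⟩, hω.2⟩

end

theorem det_ne_zero_of_diagonal_pos {L : ℕ} {κ : ℕ → ℝ}
    (hκpos : ∀ i, 1 ≤ i → i ≤ L+1 → 0 < κ i) :
    (Matrix.diagonal fun k : Fin (L+1) => κ (L+1-(k:ℕ))).det ≠ 0 := by
  rw [Matrix.det_diagonal]
  exact Finset.prod_ne_zero_iff.2 fun k _ => (hκpos _ (by omega) (by omega)).ne'

theorem stmt0 {L : ℕ} (hL : 2 ≤ L) {Ω : Type*} [MeasurableSpace Ω]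
    (P : Measure Ω) [IsProbabilityMeasure P]
    (lam : ℝ) (hlam : lam ∈ Set.Ioo (0:ℝ) 1)
    (r : Ω → ℝ) (hr : Measurable r) (hr01 : ∀ ω, r ω ∈ Set.Icc (0:ℝ) 1)
    (hr0 : P {ω | r ω = 0} < 1)
    (U : Ω → Matrix (Fin (L+1)) (Fin (L+1)) ℝ) (hU : IsHaarOrth P U)
    (hrU : IndepFun r U P)
    (κ : ℕ → ℝ) (hκpos : ∀ i, 1 ≤ i → i ≤ L+1 → 0 < κ i)
    (hκmono : ∀ i j, 1 ≤ i → i ≤ j → j ≤ L+1 → κ j ≤ κ i)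
    (R : Matrix (Fin (L+1)) (Fin (L+1)) ℝ)
    (hR : R = Matrix.diagonal fun k : Fin (L+1) => κ (L+1-(k:ℕ)))
    (ν : Measure (Sph L)) (hν : IsUniformSphere ν)
    (μ : Measure (Sph L)) [IsProbabilityMeasure μ]
    (hinv : ∀ A : Set (Sph L), MeasurableSet A →
      μ A = ∫⁻ v, P {ω | actS (R * (1 + (lam * r ω) • U ω)) v ∈ A} ∂μ) :
    μ ≪ ν := by
  have hdet : R.det ≠ 0 := hR ▸ det_ne_zero_of_diagonal_pos hκpos
  set q := P {ω | r ω = 0} with hq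
  have hstep : ∀ A : Set (Sph L), MeasurableSet A → ν A = 0 → μ A ≤ q * μ (actS R ⁻¹' A) := by
    intro A hA hνA
    rw [hinv A hA, ← lintegral_indicator_const (measurable_actS R hA)]
    refine lintegral_mono fun v => ?_
    have hsplit : P {ω | actS (R * (1 + (lam * r ω) • U ω)) v ∈ A} ≤
        P {ω | r ω = 0 ∧ actS R v ∈ A} := by
      rw [← add_zero (P {ω | r ω = 0 ∧ actS R v ∈ A}),
        ← hU.measure_pos_and_actS_mem_eq_zero hν hA hνA hdet hlam hr hr01 hrU v]
      refine (measure_mono fun ω hω => ?_).trans (measure_union_le _ _)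
      by_cases h0 : r ω = 0
      · refine Or.inl ⟨h0, ?_⟩
        simpa [h0] using hω
      · exact Or.inr ⟨h0, hω⟩
    refine hsplit.trans ?_
    by_cases hv : v ∈ actS R ⁻¹' A
    · rw [Set.indicator_of_mem hv]
      exact measure_mono fun ω hω => hω.1
    · rw [Set.indicator_of_notMem hv, nonpos_iff_eq_zero]
      exact measure_mono_null (fun ω hω => hv hω.2) measure_empty
  have hpow : ∀ n : ℕ, ∀ A : Set (Sph L), MeasurableSet A → ν A = 0 → μ A ≤ q ^ n := by
    intro n
    induction n with
    | zero => intro A _ _; rw [pow_zero]; exact prob_le_one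
    | succ n ih =>
      intro A hA hνA
      rw [pow_succ']
      exact (hstep A hA hνA).trans (mul_le_mul_right (ih _ (measurable_actS R hA)
        (measure_preimage_actS_eq_zero hU hν hA hνA hdet)) q)
  refine Measure.AbsolutelyContinuous.mk fun A hA hνA => ?_
  exact nonpos_iff_eq_zero.1 (ge_of_tendsto' (ENNReal.tendsto_pow_atTop_nhds_zero_of_lt_one hr0)
    fun n => hpow n A hA hνA)
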